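/- Let φ : ℝ_{≥0} × X → X be a continuous semiflow on a metric space (X,d), K ⊆ X a compact set and α ≥ 0. Assume there is a constant L > 0 such that d(φ_t(x),φ_t(y)) ≤ L·d(x,y) for all x,y ∈ ⋃_{s≥0} φ_s(K) and all t ∈ [0,1]. Then, computing both quantities with the natural logarithm, the continuous-time estimation entropy of the semiflow equals the discrete-time estimation entropy of its time-1-map: h_est(α,K;φ) = h_est(α,K;φ_1). -/

import Mathlib

open Filter Metric Set

/-- Minimal cardinality of a `(T,ε,α,K)`-spanning set for the semiflow `φ`. -/
noncomputable def spanNumFlow {X : Type*} [MetricSpace X] (φ : ℝ → X → X) (K : Set X)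
    (α : ℝ) (T : ℝ) (ε : ℝ) : ℕ :=
  sInf {m : ℕ | ∃ S : Finset X, ↑S ⊆ K ∧ S.card = m ∧
    ∀ x ∈ K, ∃ y ∈ S, ∀ t : ℝ, 0 ≤ t → t ≤ T →
      dist (φ t x) (φ t y) < ε * Real.exp (-α * t)}

/-- Continuous-time estimation entropy (natural logarithm); the limit as `ε ↓ 0`
is realized as the supremum over `ε > 0`, by monotonicity. -/
noncomputable def estEntropyFlow {X : Type*} [MetricSpace X] (φ : ℝ → X → X)
    (K : Set X) (α : ℝ) : EReal :=
  ⨆ ε ∈ Set.Ioi (0 : ℝ),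
    atTop.limsup fun T : ℝ => ((Real.log (spanNumFlow φ K α T ε) / T : ℝ) : EReal)

/-- Minimal cardinality of an `(n,ε,α,K)`-spanning set for a map `f`. -/
noncomputable def spanNumMap {X : Type*} [MetricSpace X] (f : X → X) (K : Set X)
    (α : ℝ) (n : ℕ) (ε : ℝ) : ℕ :=
  sInf {m : ℕ | ∃ S : Finset X, ↑S ⊆ K ∧ S.card = m ∧
    ∀ x ∈ K, ∃ y ∈ S, ∀ t : ℕ, t ≤ n →
      dist (f^[t] x) (f^[t] y) < ε * Real.exp (-α * t)}

/-- Discrete-time estimation entropy (natural logarithm). -/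
noncomputable def estEntropyMap {X : Type*} [MetricSpace X] (f : X → X) (K : Set X)
    (α : ℝ) : EReal :=
  ⨆ ε ∈ Set.Ioi (0 : ℝ),
    atTop.limsup fun n : ℕ => ((Real.log (spanNumMap f K α n ε) / n : ℝ) : EReal)

theorem iterate_time_one_eq {X : Type*} {φ : ℝ → X → X} (hid : ∀ x, φ 0 x = x)
    (hsemigroup : ∀ s t : ℝ, 0 ≤ s → 0 ≤ t → ∀ x, φ (s + t) x = φ s (φ t x))
    (k : ℕ) (x : X) : (φ 1)^[k] x = φ k x := by
  induction k with
  | zero => simp [hid]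
  | succ k ih =>
    rw [Function.iterate_succ_apply', ih, ← hsemigroup 1 k zero_le_one k.cast_nonneg]
    push_cast
    rw [add_comm]

theorem log_natCast_le_log_natCast {m n : ℕ} (h : m ≤ n) : Real.log m ≤ Real.log n := by
  rcases Nat.eq_zero_or_pos m with rfl | hm
  · simpa using Real.log_natCast_nonneg n
  · exact Real.log_le_log (by exact_mod_cast hm) (by exact_mod_cast h)

/-- A compact set has finite spanning sets for a map whose iterates expand distances on it at
most geometrically. -/
theorem exists_finset_spanning_map {X : Type*} [MetricSpace X] {f : X → X} {K : Set X}
    (hK : IsCompact K) {α : ℝ} (hα : 0 ≤ α) {L : ℝ} (hL : 0 < L)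
    (hf : ∀ k : ℕ, ∀ x ∈ K, ∀ y ∈ K, dist (f^[k] x) (f^[k] y) ≤ L ^ k * dist x y)
    (n : ℕ) {ε : ℝ} (hε : 0 < ε) :
    ∃ S : Finset X, ↑S ⊆ K ∧ ∀ x ∈ K, ∃ y ∈ S, ∀ t : ℕ, t ≤ n →
      dist (f^[t] x) (f^[t] y) < ε * Real.exp (-α * t) := by
  set M := max L 1
  have hM : 1 ≤ M := le_max_right _ _
  have hMn : 0 < M ^ n := pow_pos (by linarith) n
  have hρ : 0 < ε * Real.exp (-α * n) / M ^ n := by positivity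
  obtain ⟨s, hsK, hs, hcov⟩ := hK.finite_cover_balls hρ
  refine ⟨hs.toFinset, by simpa using hsK, fun x hx => ?_⟩
  obtain ⟨y, hy, hxy⟩ := mem_iUnion₂.1 (hcov hx)
  refine ⟨y, by simpa using hy, fun t ht => ?_⟩
  calc dist (f^[t] x) (f^[t] y) ≤ L ^ t * dist x y := hf t x hx y (hsK hy)
    _ ≤ M ^ n * dist x y := by
      gcongr
      exact (pow_le_pow_left₀ hL.le (le_max_left _ _) t).trans (pow_le_pow_right₀ hM ht)
    _ < ε * Real.exp (-α * n) := by
      rw [mem_ball, lt_div_iff₀ hMn] at hxy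
      linarith
    _ ≤ ε * Real.exp (-α * t) := by
      have : α * t ≤ α * n := by gcongr
      gcongr ε * Real.exp ?_
      linarith

/-- A spanning set for the time-one map is spanning for the semiflow, at a coarser scale. -/
theorem spanning_flow_of_spanning_map {X : Type*} [MetricSpace X] {φ : ℝ → X → X} {K : Set X}
    {α : ℝ} (hα : 0 ≤ α) {L : ℝ} (hL : 0 < L)
    (hLip : ∀ k : ℕ, ∀ t : ℝ, k ≤ t → t ≤ k + 1 → ∀ x ∈ K, ∀ y ∈ K,
      dist (φ t x) (φ t y) ≤ L * dist ((φ 1)^[k] x) ((φ 1)^[k] y))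
    {T ε : ℝ} (hε : 0 < ε) {S : Finset X} (hSK : ↑S ⊆ K)
    (hS : ∀ x ∈ K, ∃ y ∈ S, ∀ t : ℕ, t ≤ ⌊T⌋₊ →
      dist ((φ 1)^[t] x) ((φ 1)^[t] y) < ε / (L * Real.exp α) * Real.exp (-α * t)) :
    ∀ x ∈ K, ∃ y ∈ S, ∀ t : ℝ, 0 ≤ t → t ≤ T →
      dist (φ t x) (φ t y) < ε * Real.exp (-α * t) := by
  intro x hx
  obtain ⟨y, hy, h⟩ := hS x hx
  refine ⟨y, hy, fun t ht htT => ?_⟩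
  have hlt : t ≤ ⌊t⌋₊ + 1 := (Nat.lt_floor_add_one t).le
  calc dist (φ t x) (φ t y)
      ≤ L * dist ((φ 1)^[⌊t⌋₊] x) ((φ 1)^[⌊t⌋₊] y) :=
        hLip _ t (Nat.floor_le ht) hlt x hx y (hSK hy)
    _ < L * (ε / (L * Real.exp α) * Real.exp (-α * ⌊t⌋₊)) := by
      gcongr
      exact h _ (Nat.floor_mono htT)
    _ = ε * Real.exp (-α * (⌊t⌋₊ + 1)) := by
      have : Real.exp (-α * (⌊t⌋₊ + 1)) = Real.exp (-α * ⌊t⌋₊) / Real.exp α := by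
        rw [← Real.exp_sub]
        ring_nf
      rw [this]
      field_simp
    _ ≤ ε * Real.exp (-α * t) := by
      have : α * t ≤ α * (⌊t⌋₊ + 1) := by gcongr
      gcongr ε * Real.exp ?_
      linarith

/-- Let `φ` be a continuous semiflow on a metric space `(X,d)`, `K`
compact, `α ≥ 0`, and assume there is `L > 0` with `d(φ_t(x),φ_t(y)) ≤ L·d(x,y)` for
all `x,y ∈ ⋃_{s≥0} φ_s(K)` and all `t ∈ [0,1]`. Then (both computed with the natural
logarithm) the estimation entropy of the semiflow equals that of its time-1-map. -/
theorem estEntropy_flow_eq_time_one_map {X : Type*} [MetricSpace X]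
    (φ : ℝ → X → X)
    (hcont : ContinuousOn (fun p : ℝ × X => φ p.1 p.2) (Set.Ici 0 ×ˢ Set.univ))
    (hid : ∀ x, φ 0 x = x)
    (hsemigroup : ∀ s t : ℝ, 0 ≤ s → 0 ≤ t → ∀ x, φ (s + t) x = φ s (φ t x))
    (K : Set X) (hK : IsCompact K) (α : ℝ) (hα : 0 ≤ α)
    (L : ℝ) (hL : 0 < L)
    (hLip : ∀ t ∈ Set.Icc (0 : ℝ) 1,
      ∀ x ∈ ⋃ s ∈ Set.Ici (0 : ℝ), φ s '' K, ∀ y ∈ ⋃ s ∈ Set.Ici (0 : ℝ), φ s '' K,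
        dist (φ t x) (φ t y) ≤ L * dist x y) :
    estEntropyFlow φ K α = estEntropyMap (φ 1) K α := by
  set f := φ 1
  have hiter (k : ℕ) (x : X) : f^[k] x = φ k x := iterate_time_one_eq hid hsemigroup k x
  have hLip' : ∀ k : ℕ, ∀ t : ℝ, k ≤ t → t ≤ k + 1 → ∀ x ∈ K, ∀ y ∈ K,
      dist (φ t x) (φ t y) ≤ L * dist (f^[k] x) (f^[k] y) := by
    intro k t hkt htk x hx y hy
    have hmem : ∀ z ∈ K, φ k z ∈ ⋃ s ∈ Ici (0 : ℝ), φ s '' K := fun z hz =>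
      mem_iUnion₂.2 ⟨k, mem_Ici.2 k.cast_nonneg, mem_image_of_mem _ hz⟩
    have h := hLip (t - k) ⟨by linarith, by linarith⟩ _ (hmem x hx) _ (hmem y hy)
    rwa [← hsemigroup _ _ (sub_nonneg.2 hkt) k.cast_nonneg,
      ← hsemigroup _ _ (sub_nonneg.2 hkt) k.cast_nonneg, sub_add_cancel, ← hiter, ← hiter] at h
  have hpow : ∀ k : ℕ, ∀ x ∈ K, ∀ y ∈ K, dist (f^[k] x) (f^[k] y) ≤ L ^ k * dist x y := by
    intro k x hx y hy
    induction k with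
    | zero => simp
    | succ k ih =>
      have h := hLip' k (k + 1 : ℕ) (by simp) (by simp) x hx y hy
      rw [← hiter, ← hiter] at h
      refine h.trans ?_
      rw [pow_succ', mul_assoc]
      gcongr
  have hmap_le (n : ℕ) {ε : ℝ} (hε : 0 < ε) :
      spanNumMap f K α n ε ≤ spanNumFlow φ K α n ε := by
    obtain ⟨S₀, hS₀K, hS₀⟩ := exists_finset_spanning_map hK hα hL hpow ⌊(n : ℝ)⌋₊
      (ε := ε / (L * Real.exp α)) (by positivity)
    obtain ⟨S, hSK, hcard, hS⟩ := Nat.sInf_mem (s := {m : ℕ | ∃ S : Finset X, ↑S ⊆ K ∧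
      S.card = m ∧ ∀ x ∈ K, ∃ y ∈ S, ∀ t : ℝ, 0 ≤ t → t ≤ n →
        dist (φ t x) (φ t y) < ε * Real.exp (-α * t)})
      ⟨_, S₀, hS₀K, rfl, spanning_flow_of_spanning_map hα hL hLip' hε hS₀K hS₀⟩
    refine Nat.sInf_le ⟨S, hSK, hcard, fun x hx => ?_⟩
    obtain ⟨y, hy, h⟩ := hS x hx
    refine ⟨y, hy, fun t ht => ?_⟩
    rw [hiter, hiter]
    exact h t t.cast_nonneg (by exact_mod_cast ht)
  have hflow_le (T : ℝ) {ε : ℝ} (hε : 0 < ε) :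
      spanNumFlow φ K α T ε ≤ spanNumMap f K α ⌊T⌋₊ (ε / (L * Real.exp α)) := by
    obtain ⟨S₀, hS₀K, hS₀⟩ := exists_finset_spanning_map hK hα hL hpow ⌊T⌋₊
      (ε := ε / (L * Real.exp α)) (by positivity)
    obtain ⟨S, hSK, hcard, hS⟩ := Nat.sInf_mem (s := {m : ℕ | ∃ S : Finset X, ↑S ⊆ K ∧
      S.card = m ∧ ∀ x ∈ K, ∃ y ∈ S, ∀ t : ℕ, t ≤ ⌊T⌋₊ →
        dist (f^[t] x) (f^[t] y) < ε / (L * Real.exp α) * Real.exp (-α * t)})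
      ⟨_, S₀, hS₀K, rfl, hS₀⟩
    exact Nat.sInf_le ⟨S, hSK, hcard, spanning_flow_of_spanning_map hα hL hLip' hε hSK hS⟩
  apply le_antisymm
  · refine iSup₂_le fun ε (hε : 0 < ε) => ?_
    have hδ : 0 < ε / (L * Real.exp α) := by positivity
    refine le_trans ?_ (le_iSup₂_of_le _ hδ le_rfl)
    refine le_trans ?_ (limsup_le_limsup_of_le (tendsto_nat_floor_atTop (α := ℝ)))
    rw [← limsup_comp]
    refine limsup_le_limsup ?_
    filter_upwards [eventually_ge_atTop (1 : ℝ)] with T hT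
    have hfloor : 0 < ⌊T⌋₊ := Nat.floor_pos.2 hT
    refine EReal.coe_le_coe_iff.2 (div_le_div₀ (Real.log_natCast_nonneg _)
      (log_natCast_le_log_natCast (hflow_le T hε)) (by exact_mod_cast hfloor)
      (Nat.floor_le (by linarith)))
  · refine iSup₂_mono fun ε (hε : 0 < ε) => ?_
    refine le_trans ?_ (limsup_le_limsup_of_le (tendsto_natCast_atTop_atTop (R := ℝ)))
    rw [← limsup_comp]
    refine limsup_le_limsup (Eventually.of_forall fun n => ?_)
    exact EReal.coe_le_coe_iff.2 (div_le_div_of_nonneg_right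
      (log_natCast_le_log_natCast (hmap_le n hε)) n.cast_nonneg)
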